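/- In a simple Edge Firing Game, for reachable configurations C and C', the configuration C covers C' in the configuration space (i.e. C > C' and there is no reachable D with C > D > C') if and only if C' is obtained from C by firing a single vertex. -/

import Mathlib

namespace EFG

variable {V : Type*}

/-- An orientation of the undirected graph `G`: for each edge `{u,v}` of `G`, exactly one
of the directions `u → v`, `v → u` is present, and there are no other arcs. -/
structure Orientation {V : Type*} (G : SimpleGraph V) where
  dir : V → V → Prop
  adj_of_dir : ∀ ⦃u v : V⦄, dir u v → G.Adj u v
  dir_iff_not : ∀ ⦃u v : V⦄, G.Adj u v → (dir u v ↔ ¬ dir v u)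

/-- In the EFG with sink `s`, the vertex `v` is firable in the configuration `C`:
`v` is not the sink and every edge incident to `v` is directed toward `v`. -/
def Firable {G : SimpleGraph V} (s : V) (C : Orientation G) (v : V) : Prop :=
  v ≠ s ∧ ∀ u : V, G.Adj u v → C.dir u v

/-- `C'` is obtained from `C` by firing the vertex `v`: `v` is firable in `C` and all
edges incident to `v` are reversed, all other edges keeping their orientation. -/
def Fires {G : SimpleGraph V} (s : V) (C : Orientation G) (v : V) (C' : Orientation G) : Prop :=
  Firable s C v ∧
    (∀ a b : V, (a = v ∨ b = v) → (C'.dir a b ↔ C.dir b a)) ∧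
    (∀ a b : V, a ≠ v → b ≠ v → (C'.dir a b ↔ C.dir a b))

/-- `FireSeq s C l C'`: the sequence of firings `l` transforms `C` into `C'`. -/
inductive FireSeq {G : SimpleGraph V} (s : V) : Orientation G → List V → Orientation G → Prop
  | nil (C : Orientation G) : FireSeq s C [] C
  | cons {C C' C'' : Orientation G} {v : V} {l : List V} :
      Fires s C v C' → FireSeq s C' l C'' → FireSeq s C (v :: l) C''

/-- `C` is reachable from the initial configuration `G₀`. -/
def Reach {G : SimpleGraph V} (s : V) (G₀ C : Orientation G) : Prop :=
  ∃ l : List V, FireSeq s G₀ l C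

/-- The EFG with sink `s` and initial configuration `G₀` is simple: in every sequence of
firings starting from `G₀`, each vertex is fired at most once. -/
def IsSimple {G : SimpleGraph V} (s : V) (G₀ : Orientation G) : Prop :=
  ∀ (l : List V) (C : Orientation G), FireSeq s G₀ l C → l.Nodup

/-- The configuration space of the EFG: reachable configurations,
ordered by `C ≤ C'` iff `C` can be obtained from `C'` by a sequence of firings. -/
def ConfigSpace (G : SimpleGraph V) (s : V) (G₀ : Orientation G) : Type _ :=
  {C : Orientation G // Reach s G₀ C}

instance {G : SimpleGraph V} {s : V} {G₀ : Orientation G} : LE (ConfigSpace G s G₀) :=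
  ⟨fun C C' => ∃ l : List V, FireSeq s C'.1 l C.1⟩


theorem FireSeq.append {G : SimpleGraph V} {s : V} {C D E : Orientation G} {l m : List V}
    (h : FireSeq s C l D) (h' : FireSeq s D m E) : FireSeq s C (l ++ m) E := by
  induction h with
  | nil => exact h'
  | cons hf _ ih => exact .cons hf (ih h')

theorem FireSeq.eq_of_nil {G : SimpleGraph V} {s : V} {C D : Orientation G}
    (h : FireSeq s C [] D) : C = D := by
  cases h
  rfl

theorem FireSeq.sink_notMem {G : SimpleGraph V} {s : V} {C D : Orientation G} {l : List V}
    (h : FireSeq s C l D) : s ∉ l := by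
  induction h with
  | nil => simp
  | cons hf _ ih => simp [ih, hf.1.1.symm]

/-- An edge keeps its direction along a sequence of firings iff its two endpoints are fired
an even number of times in total. -/
theorem FireSeq.dir_iff [DecidableEq V] {G : SimpleGraph V} {s : V} {C D : Orientation G}
    {l : List V} (h : FireSeq s C l D) {a b : V} (hab : G.Adj a b) :
    D.dir a b ↔ (C.dir a b ↔ Even (l.count a + l.count b)) := by
  induction h with
  | nil => simp
  | @cons C C' C'' v l hf _ ih =>
    rw [ih]
    have hne := hab.ne
    have hflip := C.dir_iff_not hab
    by_cases hav : a = v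
    · subst hav
      rw [hf.2.1 a b (.inl rfl), List.count_cons_self, List.count_cons_of_ne hne,
        Nat.add_right_comm, Nat.even_add_one]
      tauto
    · by_cases hbv : b = v
      · subst hbv
        rw [hf.2.1 a b (.inr rfl), List.count_cons_self, List.count_cons_of_ne hne.symm,
          ← Nat.add_assoc, Nat.even_add_one]
        tauto
      · rw [hf.2.2 a b hav hbv, List.count_cons_of_ne (Ne.symm hav),
          List.count_cons_of_ne (Ne.symm hbv)]

/-- On a connected graph, the endpoints of a sequence of firings determine the parity of the
number of times each vertex is fired. -/
theorem FireSeq.even_count_iff [DecidableEq V] {G : SimpleGraph V} (hconn : G.Connected) {s : V}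
    {C D : Orientation G} {l m : List V} (hl : FireSeq s C l D) (hm : FireSeq s C m D) (a : V) :
    Even (l.count a) ↔ Even (m.count a) := by
  obtain ⟨p⟩ := hconn.preconnected a s
  induction p with
  | nil =>
    rw [List.count_eq_zero_of_not_mem hl.sink_notMem, List.count_eq_zero_of_not_mem hm.sink_notMem]
  | cons hadj _ ih =>
    have h₁ := hl.dir_iff hadj
    have h₂ := hm.dir_iff hadj
    have h₃ := ih hl hm
    rw [Nat.even_add] at h₁ h₂
    tauto

theorem FireSeq.perm_of_nodup {G : SimpleGraph V} (hconn : G.Connected) {s : V}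
    {C D : Orientation G} {l m : List V} (hl : FireSeq s C l D) (hm : FireSeq s C m D)
    (hln : l.Nodup) (hmn : m.Nodup) : l.Perm m := by
  classical
  rw [List.perm_ext_iff_of_nodup hln hmn]
  intro a
  have h := hl.even_count_iff hconn hm a
  rw [hln.count, hmn.count] at h
  split_ifs at h <;> simp_all

theorem IsSimple.nodup_of_reach {G : SimpleGraph V} {s : V} {G₀ C D : Orientation G}
    (hsimple : IsSimple s G₀) (hC : Reach s G₀ C) {l : List V} (hl : FireSeq s C l D) :
    l.Nodup := by
  obtain ⟨k, hk⟩ := hC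
  exact (hsimple _ _ (hk.append hl)).of_append_right

theorem Fires.ne {G : SimpleGraph V} (hconn : G.Connected) {s v : V} {C D : Orientation G}
    (h : Fires s C v D) : C ≠ D := by
  rintro rfl
  have : Nontrivial V := ⟨v, s, h.1.1⟩
  obtain ⟨u, hu⟩ := hconn.preconnected.exists_adj_of_nontrivial v
  have h₁ := h.2.1 u v (.inr rfl)
  have h₂ := C.dir_iff_not hu
  tauto

/-- in a simple EFG, a reachable configuration `C` covers a reachable
configuration `C'` in the configuration space iff `C'` is obtained from `C` by firing a
single vertex. -/
theorem covers_iff_single_firing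
    {V : Type*} [Fintype V] {G : SimpleGraph V} (hconn : G.Connected)
    (s : V) (G₀ : Orientation G) (hsimple : IsSimple s G₀)
    (C C' : Orientation G) (hC : Reach s G₀ C) (hC' : Reach s G₀ C') :
    ((∃ l : List V, FireSeq s C l C') ∧ C ≠ C' ∧
        ¬ ∃ D : Orientation G, Reach s G₀ D ∧
          (∃ l : List V, FireSeq s C l D) ∧ C ≠ D ∧
          (∃ l : List V, FireSeq s D l C') ∧ D ≠ C') ↔
      ∃ v : V, Fires s C v C' := by
  constructor
  · rintro ⟨⟨l, hl⟩, hne, hcov⟩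
    cases hl with
    | nil => exact absurd rfl hne
    | @cons _ D _ v l hf hl =>
      by_cases hD : D = C'
      · exact ⟨v, hD ▸ hf⟩
      · obtain ⟨k, hk⟩ := hC
        have hCD : FireSeq s C [v] D := .cons hf (.nil D)
        exact absurd ⟨D, ⟨_, hk.append hCD⟩, ⟨_, hCD⟩, hf.ne hconn, ⟨l, hl⟩, hD⟩ hcov
  · rintro ⟨v, hf⟩
    have hv : FireSeq s C [v] C' := .cons hf (.nil C')
    refine ⟨⟨_, hv⟩, hf.ne hconn, ?_⟩
    rintro ⟨D, -, ⟨l, hl⟩, hCD, ⟨m, hm⟩, hDC'⟩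
    have hlm := hl.append hm
    have hlen := (hlm.perm_of_nodup hconn hv (hsimple.nodup_of_reach hC hlm)
      (List.nodup_singleton v)).length_eq
    have hl₀ : l ≠ [] := by rintro rfl; exact hCD hl.eq_of_nil
    have hm₀ : m ≠ [] := by rintro rfl; exact hDC' hm.eq_of_nil
    have := List.length_pos_iff.2 hl₀
    have := List.length_pos_iff.2 hm₀
    simp only [List.length_append, List.length_singleton] at hlen
    omega

end EFG
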